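/- Let H be a cocommutative Hopf algebra over a commutative ring k, and let X = H⊗H with the tensor-product comultiplication Δ_X(x⊗y) = (x⁽¹⁾⊗y⁽¹⁾) ⊗ (x⁽²⁾⊗y⁽²⁾), the right H-action (x⊗y)·g = (x g⁽¹⁾) ⊗ (y g⁽²⁾), and augmentation map ν(x⊗y) = S(x)y. The associated R-matrix R : X⊗X → X⊗X, R(w⊗z) = z⁽¹⁾ ⊗ (w·ν(z⁽²⁾)), explicitly R((x⊗y)⊗(u⊗v)) = (u⁽¹⁾⊗v⁽¹⁾) ⊗ ( x·(S(u⁽²⁾)v⁽²⁾)⁽¹⁾ ⊗ y·(S(u⁽²⁾)v⁽²⁾)⁽²⁾ ) where here x·h = xh is multiplication in H, satisfies the Yang–Baxter equation (R⊗1)∘(1⊗R)∘(R⊗1) = (1⊗R)∘(R⊗1)∘(1⊗R) on X⊗X⊗X. -/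

import Mathlib

open TensorProduct

variable (k : Type*) [CommRing k] (H : Type*) [Ring H] [HopfAlgebra k H]

/-- The quantum-heap augmentation map `ν : H ⊗ H → H`, `ν(x ⊗ y) = S(x) y`. -/
noncomputable def heapNu : H ⊗[k] H →ₗ[k] H :=
  LinearMap.mul' k H ∘ₗ LinearMap.rTensor H (HopfAlgebra.antipode (R := k))

/-- The tensor-product comultiplication on `X = H ⊗ H`:
`Δ_X(x ⊗ y) = (x⁽¹⁾ ⊗ y⁽¹⁾) ⊗ (x⁽²⁾ ⊗ y⁽²⁾)`. -/
noncomputable def comulX : H ⊗[k] H →ₗ[k] (H ⊗[k] H) ⊗[k] (H ⊗[k] H) :=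
  (TensorProduct.tensorTensorTensorComm k H H H H).toLinearMap ∘ₗ
    TensorProduct.map (Coalgebra.comul (R := k)) (Coalgebra.comul (R := k))

/-- The right `H`-action on `X = H ⊗ H`: `(x ⊗ y) · g = (x g⁽¹⁾) ⊗ (y g⁽²⁾)`. -/
noncomputable def heapAct : (H ⊗[k] H) ⊗[k] H →ₗ[k] H ⊗[k] H :=
  TensorProduct.map (LinearMap.mul' k H) (LinearMap.mul' k H) ∘ₗ
    (TensorProduct.tensorTensorTensorComm k H H H H).toLinearMap ∘ₗ
    LinearMap.lTensor (H ⊗[k] H) (Coalgebra.comul (R := k))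

/-- The associated SD map `q(w ⊗ z) = w · ν(z)` on `X = H ⊗ H`. -/
noncomputable def heapQ : (H ⊗[k] H) ⊗[k] (H ⊗[k] H) →ₗ[k] H ⊗[k] H :=
  heapAct k H ∘ₗ LinearMap.lTensor (H ⊗[k] H) (heapNu k H)

/-- The associated R-matrix `R(w ⊗ z) = z⁽¹⁾ ⊗ q(w ⊗ z⁽²⁾)` on `X ⊗ X`, `X = H ⊗ H`. -/
noncomputable def heapR : (H ⊗[k] H) ⊗[k] (H ⊗[k] H) →ₗ[k] (H ⊗[k] H) ⊗[k] (H ⊗[k] H) :=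
  LinearMap.lTensor (H ⊗[k] H) (heapQ k H) ∘ₗ
    (TensorProduct.leftComm k (H ⊗[k] H) (H ⊗[k] H) (H ⊗[k] H)).toLinearMap ∘ₗ
    LinearMap.lTensor (H ⊗[k] H) (comulX k H)

/-- `R ⊗ 1` as a map on `M ⊗ (M ⊗ M)`. -/
noncomputable def rOne (M : Type*) [AddCommGroup M] [Module k M]
    (R : M ⊗[k] M →ₗ[k] M ⊗[k] M) : M ⊗[k] (M ⊗[k] M) →ₗ[k] M ⊗[k] (M ⊗[k] M) :=
  (TensorProduct.assoc k M M M).toLinearMap ∘ₗ LinearMap.rTensor M R ∘ₗ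
    (TensorProduct.assoc k M M M).symm.toLinearMap

section QuantumHeap

open Coalgebra HopfAlgebra WithConv

section Coalgebra

variable {R C ι : Type*} [CommSemiring R] [AddCommMonoid C] [Module R C] [Coalgebra R C]

/-- In a cocommutative coalgebra, `c⁽¹⁾ ⊗ c⁽²⁾ ⊗ c⁽³⁾ = c⁽²⁾ ⊗ c⁽¹⁾ ⊗ c⁽³⁾`. -/
theorem Coalgebra.leftComm_lTensor_comul_comul [IsCocomm R C] (c : C) :
    TensorProduct.leftComm R C C C (comul.lTensor C (comul (R := R) c)) =
      comul.lTensor C (comul (R := R) c) := by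
  have h : ∀ t : C ⊗[R] C, _root_.TensorProduct.leftComm R C C C
      (_root_.TensorProduct.assoc R C C C (comul.rTensor C t)) =
        _root_.TensorProduct.assoc R C C C (comul.rTensor C t) := by
    intro t
    induction t with
    | zero => simp
    | add x y hx hy => simp only [map_add, hx, hy]
    | tmul x y =>
      have h' : ∀ s : C ⊗[R] C, TensorProduct.leftComm R C C C
          (_root_.TensorProduct.assoc R C C C (s ⊗ₜ y)) =
            _root_.TensorProduct.assoc R C C C (TensorProduct.comm R C C s ⊗ₜ y) := by
        intro s
        induction s with
        | zero => simp
        | add s t hs ht => simp only [map_add, TensorProduct.add_tmul, hs, ht]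
        | tmul s t => simp
      rw [LinearMap.rTensor_tmul, h', comm_comul]
  simpa only [coassoc_apply] using h (comul c)

theorem Coalgebra.Repr.sum_leftComm [IsCocomm R C] {c : C} (r : Repr R c ι) {κ : ι → Type*}
    (r' : ∀ i, Repr R (r.right i) (κ i)) :
    ∑ i ∈ r.index, ∑ j ∈ (r' i).index, (r' i).left j ⊗ₜ[R] (r.left i ⊗ₜ[R] (r' i).right j) =
      ∑ i ∈ r.index, ∑ j ∈ (r' i).index,
        r.left i ⊗ₜ[R] ((r' i).left j ⊗ₜ[R] (r' i).right j) := by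
  simpa [← r.eq, ← (r' _).eq, TensorProduct.tmul_sum] using
    leftComm_lTensor_comul_comul (R := R) c

end Coalgebra

/-- Let `act` be a bilinear operation on a coalgebra `X` and `R(w ⊗ z) = z⁽¹⁾ ⊗ act w z⁽²⁾`. If
`R` commutes with the diagonal right translations by `act`, then `R` satisfies the Yang–Baxter
equation. -/
theorem yang_baxter_of_equivariant {K X : Type*} [CommRing K] [AddCommGroup X] [Module K X]
    [Coalgebra K X] (R : X ⊗[K] X →ₗ[K] X ⊗[K] X) (act : X →ₗ[K] X →ₗ[K] X)
    (hR : ∀ w z, R (w ⊗ₜ z) = ∑ i ∈ (ℛ K z).index, (ℛ K z).left i ⊗ₜ act w ((ℛ K z).right i))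
    (hequiv : ∀ a b c, ∑ j ∈ (ℛ K c).index,
        R (act a ((ℛ K c).left j) ⊗ₜ act b ((ℛ K c).right j)) =
      ∑ i ∈ (ℛ K b).index, ∑ j ∈ (ℛ K c).index, act ((ℛ K b).left i) ((ℛ K c).left j) ⊗ₜ
        act (act a ((ℛ K b).right i)) ((ℛ K c).right j)) :
    rOne K X R ∘ₗ R.lTensor X ∘ₗ rOne K X R = R.lTensor X ∘ₗ rOne K X R ∘ₗ R.lTensor X := by
  have hrOne (x w z : X) : rOne K X R (w ⊗ₜ (z ⊗ₜ x)) =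
      ∑ i ∈ (ℛ K z).index, (ℛ K z).left i ⊗ₜ (act w ((ℛ K z).right i) ⊗ₜ x) := by
    simp [rOne, hR, TensorProduct.sum_tmul]
  refine TensorProduct.ext (LinearMap.ext fun a ↦ TensorProduct.ext' fun b c ↦ ?_)
  have hcoassoc (w z : X) := congr((TensorProduct.map (act w) (act z)).lTensor X
    $(sum_tmul_tmul_eq (ℛ K c) (fun i ↦ ℛ K ((ℛ K c).left i)) (fun i ↦ ℛ K ((ℛ K c).right i))))
  simp only [map_sum, LinearMap.lTensor_tmul, TensorProduct.map_tmul] at hcoassoc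
  simp only [LinearMap.compr₂ₛₗ_apply, TensorProduct.mk_apply, LinearMap.comp_apply, hrOne, hR,
    map_sum, LinearMap.lTensor_tmul, TensorProduct.tmul_sum, hcoassoc]
  rw [Finset.sum_comm]
  simp only [hR] at hequiv
  simp only [← TensorProduct.tmul_sum, hequiv]

section HopfAlgebra

variable {R A : Type*} [CommSemiring R] [Semiring A] [HopfAlgebra R A] [IsCocomm R A]

/-- The antipode of a cocommutative Hopf algebra commutes with comultiplication. -/
theorem HopfAlgebra.map_antipode_comp_comul :
    TensorProduct.map (antipode R) (antipode R) ∘ₗ comul (R := R) (A := A) =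
      comul ∘ₗ antipode R := by
  apply WithConv.toConv_injective
  refine left_inv_eq_right_inv (a := toConv (comul (R := R) (A := A))) ?_
    LinearMap.comul_right_inv
  have h := LinearMap.convMul_comp_coalgHom_distrib (toConv (antipode R (A := A ⊗[R] A)))
    (toConv LinearMap.id) (comulCoalgHom R A)
  rw [LinearMap.antipode_mul_id] at h
  apply WithConv.ofConv_injective
  refine Eq.trans h.symm ?_
  ext a
  exact congr(algebraMap R (A ⊗[R] A)
    $(LinearMap.congr_fun (comulCoalgHom R A).counit_comp a))

variable (R A) in
/-- The antipode of a cocommutative Hopf algebra as a coalgebra hom. -/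
noncomputable def HopfAlgebra.antipodeCoalgHom : A →ₗc[R] A where
  __ := antipode R
  counit_comp := counit_comp_antipode
  map_comp_comul := map_antipode_comp_comul

end HopfAlgebra

variable {k H}

theorem heapAct_tmul (w : H ⊗[k] H) (g : H) :
    heapAct k H (w ⊗ₜ g) = w * comul (R := k) g := by
  induction w with
  | zero => simp
  | add x y hx hy => rw [TensorProduct.add_tmul, map_add, hx, hy, add_mul]
  | tmul x y =>
    simp [heapAct, ← (ℛ k g).eq, TensorProduct.tmul_sum, Finset.mul_sum]

theorem comulX_eq_comul : comulX k H = comul (R := k) (A := H ⊗[k] H) := rfl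

theorem heapR_tmul {ι : Type*} (w : H ⊗[k] H) {z : H ⊗[k] H} (r : Repr k z ι) :
    heapR k H (w ⊗ₜ z) =
      ∑ i ∈ r.index, r.left i ⊗ₜ (w * comul (R := k) (heapNu k H (r.right i))) := by
  simp [heapR, heapQ, comulX_eq_comul, ← r.eq, TensorProduct.tmul_sum, heapAct_tmul]

/-- The augmentation satisfies `ν(z · g) = S(g⁽¹⁾) ν(z) g⁽²⁾`. -/
theorem heapNu_mul_comul {ι : Type*} (z : H ⊗[k] H) {g : H} (r : Repr k g ι) :
    heapNu k H (z * comul (R := k) g) =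
      ∑ i ∈ r.index, antipode k (r.left i) * (heapNu k H z * r.right i) := by
  induction z with
  | zero => simp
  | add x y hx hy => simp only [add_mul, mul_add, map_add, hx, hy, Finset.sum_add_distrib]
  | tmul x y =>
    simp [heapNu, ← r.eq, Finset.mul_sum, antipode_mul_antidistrib, mul_assoc]

theorem sum_mul_heapNu_mul_comul {ι : Type*} (z : H ⊗[k] H) {g : H} (r : Repr k g ι) :
    ∑ i ∈ r.index, r.left i * heapNu k H (z * comul (R := k) (r.right i)) =
      heapNu k H z * g := by
  have h := congr((LinearMap.mul' k H ∘ₗ (LinearMap.mul' k H ∘ₗ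
      TensorProduct.map (antipode k) (LinearMap.mulLeft k (heapNu k H z))).lTensor H)
    $(sum_tmul_tmul_eq r (fun i ↦ ℛ k (r.left i)) (fun i ↦ ℛ k (r.right i))))
  simp only [map_sum, LinearMap.comp_apply, LinearMap.lTensor_tmul, TensorProduct.map_tmul,
    LinearMap.mul'_apply, LinearMap.mulLeft_apply] at h
  simp only [heapNu_mul_comul z (ℛ k (r.right _)), Finset.mul_sum]
  rw [← h]
  simp only [← mul_assoc, ← Finset.sum_mul, sum_mul_antipode_eq_smul]
  simp only [smul_mul_assoc, one_mul, ← mul_smul_comm, ← Finset.mul_sum, sum_counit_smul]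

variable [IsCocomm k H]

variable (k H) in
/-- For cocommutative `H`, the augmentation `ν` is a coalgebra hom. -/
noncomputable def heapNuCoalgHom : H ⊗[k] H →ₗc[k] H :=
  (Bialgebra.mulCoalgHom k H).comp
    (Coalgebra.TensorProduct.map (antipodeCoalgHom k H) (CoalgHom.id k H))

/-- The R-matrix commutes with the diagonal action of `H`. -/
theorem heapR_equivariant {ι κ : Type*} (a : H ⊗[k] H) {b : H ⊗[k] H} {g : H}
    (r : Repr k g ι) (s : Repr k b κ) :
    ∑ j ∈ r.index, heapR k H ((a * comul (R := k) (r.left j)) ⊗ₜ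
        (b * comul (R := k) (r.right j))) =
      ∑ i ∈ s.index, ∑ j ∈ r.index, (s.left i * comul (R := k) (r.left j)) ⊗ₜ
        (a * comul (R := k) (heapNu k H (s.right i)) * comul (R := k) (r.right j)) := by
  have hR (j : ι) := heapR_tmul (a * comul (R := k) (r.left j))
    (s.mul ((ℛ k (r.right j)).induced (comulCoalgHom k H)))
  have hc (h : H) : comulCoalgHom k H h = comul (R := k) h := rfl
  have hswap (i : κ) := congr((TensorProduct.map
      (LinearMap.mulLeft k (s.left i) ∘ₗ comul (R := k))
      (LinearMap.mulLeft k a ∘ₗ comul (R := k) ∘ₗ LinearMap.mul' k H ∘ₗ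
        (heapNu k H ∘ₗ LinearMap.mulLeft k (s.right i) ∘ₗ comul (R := k)).lTensor H))
    $(r.sum_leftComm (fun j ↦ ℛ k (r.right j))))
  simp only [map_sum, LinearMap.comp_apply, LinearMap.lTensor_tmul, TensorProduct.map_tmul,
    LinearMap.mul'_apply, LinearMap.mulLeft_apply] at hswap
  simp only [hc] at hR
  simp only [hR, Repr.mul_index, Repr.mul_left, Repr.mul_right, Finset.sum_product,
    Repr.induced_index, Repr.induced_left, Repr.induced_right, Function.comp_apply, hc,
    mul_assoc, ← Bialgebra.comul_mul]
  rw [Finset.sum_comm]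
  refine Finset.sum_congr rfl fun i _ ↦ (hswap i).trans ?_
  refine Finset.sum_congr rfl fun j _ ↦ ?_
  rw [← TensorProduct.tmul_sum, ← Finset.mul_sum, ← map_sum, sum_mul_heapNu_mul_comul]

end QuantumHeap

/-- for a cocommutative Hopf algebra `H`, the quantum-heap R-matrix on
`X = H ⊗ H` satisfies the Yang–Baxter equation. -/
theorem quantumHeap_R_matrix_yang_baxter
    (hcocomm : ∀ g : H, (TensorProduct.comm k H H) (Coalgebra.comul (R := k) g) =
      Coalgebra.comul (R := k) g) :
    rOne k (H ⊗[k] H) (heapR k H) ∘ₗ LinearMap.lTensor (H ⊗[k] H) (heapR k H) ∘ₗ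
        rOne k (H ⊗[k] H) (heapR k H) =
      LinearMap.lTensor (H ⊗[k] H) (heapR k H) ∘ₗ rOne k (H ⊗[k] H) (heapR k H) ∘ₗ
        LinearMap.lTensor (H ⊗[k] H) (heapR k H) := by
  have : Coalgebra.IsCocomm k H := ⟨LinearMap.ext hcocomm⟩
  refine yang_baxter_of_equivariant (heapR k H)
    ((LinearMap.mul k (H ⊗[k] H)).compl₂ (Coalgebra.comul (R := k) ∘ₗ heapNu k H))
    (fun w z ↦ heapR_tmul w _) fun a b c ↦ ?_
  exact heapR_equivariant a
    ((Coalgebra.Repr.arbitrary k c).induced (heapNuCoalgHom k H)) (Coalgebra.Repr.arbitrary k b)
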